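/- For every ECTA A, the language of the existential Alur–Dill region automaton is contained in the untimed language of A: L(RA(∃,Reg,A)) ⊆ Untime(L(A)). Combining with the converse inclusion, L(RA(∃,Reg,A)) = Untime(L(A)), so the existential region automaton is a finite automaton recognizing exactly the untimed language of A. -/

import Mathlib

/-- Event clocks over alphabet `α`: a history clock and a prophecy clock per letter. -/
inductive Clock (α : Type) where
  | hist (a : α)
  | proph (a : α)
deriving DecidableEq

/-- A valuation assigns to each event clock a real value or `⊥` (here `none`). -/
def Val (α : Type) := Clock α → Option ℝ

/-- All defined clock values are nonnegative. -/
def Nonneg {α : Type} (v : Val α) : Prop := ∀ x r, v x = some r → 0 ≤ r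

/-- `v[x := d]`. -/
def Val.set {α : Type} [DecidableEq α] (v : Val α) (x : Clock α) (d : Option ℝ) : Val α :=
  fun y => if y = x then d else v y

/-- Time elapse: history clocks increase, prophecy clocks decrease; `⊥` unaffected. -/
def elapse {α : Type} (v : Val α) (t : ℝ) : Val α := fun c =>
  match c with
  | .hist a => (v (.hist a)).map (· + t)
  | .proph a => (v (.proph a)).map (· - t)

/-- Time elapse by `t` is allowed: `t ≥ 0` and all prophecy clocks are at least `t`. -/
def CanElapse {α : Type} (v : Val α) (t : ℝ) : Prop :=
  0 ≤ t ∧ ∀ a r, v (.proph a) = some r → t ≤ r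

def InitialVal {α : Type} (v : Val α) : Prop := ∀ a, v (.hist a) = none

def FinalVal {α : Type} (v : Val α) : Prop := ∀ a, v (.proph a) = none

/-- Clock constraints: Boolean combinations of atomic constraints `x ∼ c`. -/
inductive Constr (α : Type) where
  | tt
  | lt (x : Clock α) (c : ℕ)
  | gt (x : Clock α) (c : ℕ)
  | eq (x : Clock α) (c : ℕ)
  | not (ψ : Constr α)
  | and (ψ₁ ψ₂ : Constr α)

def Constr.sat {α : Type} (v : Val α) : Constr α → Prop
  | .tt => True
  | .lt x c => ∃ r, v x = some r ∧ r < (c : ℝ)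
  | .gt x c => ∃ r, v x = some r ∧ (c : ℝ) < r
  | .eq x c => v x = some (c : ℝ)
  | .not ψ => ¬ Constr.sat v ψ
  | .and ψ₁ ψ₂ => Constr.sat v ψ₁ ∧ Constr.sat v ψ₂

/-- An event-clock automaton. -/
structure ECTA (α Q : Type) where
  init : Q
  edges : Set (Q × α × Constr α × Q)
  accept : Set Q

/-- Discrete step on letter `σ`: there is a nonnegative valuation `v̄` with
`v̄[→σ := 0] = v`, `v̄[←σ := 0] = v'` and `v̄ ⊨ ψ` for some edge `(q,σ,ψ,q')`. -/
def DStep {α Q : Type} [DecidableEq α] (A : ECTA α Q) (q : Q) (v : Val α) (σ : α)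
    (q' : Q) (v' : Val α) : Prop :=
  ∃ ψ, (q, σ, ψ, q') ∈ A.edges ∧
    ∃ vb : Val α, Nonneg vb ∧
      vb.set (.proph σ) (some 0) = v ∧
      vb.set (.hist σ) (some 0) = v' ∧
      Constr.sat vb ψ

/-- Combined step: elapse `t`, then fire a `σ`-edge. -/
def TStep {α Q : Type} [DecidableEq α] (A : ECTA α Q) (q : Q) (v : Val α) (t : ℝ) (σ : α)
    (q' : Q) (v' : Val α) : Prop :=
  CanElapse v t ∧ DStep A q (elapse v t) σ q' v'

/-- Acceptance of a timed word (given by successive delays) from state `(q,v)`. -/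
inductive ECAcc {α Q : Type} [DecidableEq α] (A : ECTA α Q) : Q → Val α → List (ℝ × α) → Prop where
  | nil : ∀ q v, q ∈ A.accept → FinalVal v → ECAcc A q v []
  | cons : ∀ q v t σ q' v' w, TStep A q v t σ q' v' → ECAcc A q' v' w → ECAcc A q v ((t, σ) :: w)

/-- `Untime(L(A,(q,v)))`. -/
def UntimedLangFrom {α Q : Type} [DecidableEq α] (A : ECTA α Q) (q : Q) (v : Val α) :
    Set (List α) :=
  { w | ∃ θ : List (ℝ × α), ECAcc A q v θ ∧ θ.map Prod.snd = w }

/-- The timed language of `A` (initialized runs). -/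
def TLang {α Q : Type} [DecidableEq α] (A : ECTA α Q) : Set (List (ℝ × α)) :=
  { θ | ∃ v, Nonneg v ∧ InitialVal v ∧ ECAcc A A.init v θ }

/-- `Untime(L(A))`. -/
def UntimedLang {α Q : Type} [DecidableEq α] (A : ECTA α Q) : Set (List α) :=
  { w | ∃ v, Nonneg v ∧ InitialVal v ∧ w ∈ UntimedLangFrom A A.init v }
/-- Distance to the relevant integer boundary: `⌈r⌉ − r` for history clocks,
`r − ⌊r⌋` for prophecy clocks. -/
noncomputable def fracDist {α : Type} : Clock α → ℝ → ℝ
  | .hist _, r => (⌈r⌉ : ℝ) - r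
  | .proph _, r => r - (⌊r⌋ : ℝ)

/-- Signed value used for diagonal constraints: prophecy clocks are negated. -/
def sval {α : Type} : Clock α → ℝ → ℝ
  | .hist _, r => r
  | .proph _, r => -r

/-- The Alur–Dill region equivalence with maximal constant `cmax`. -/
def RegEq {α : Type} (cmax : ℕ) (v₁ v₂ : Val α) : Prop :=
  (∀ x, v₁ x = none ↔ v₂ x = none) ∧
  (∀ x r₁ r₂, v₁ x = some r₁ → v₂ x = some r₂ →
      (((cmax : ℝ) < r₁ ∧ (cmax : ℝ) < r₂) ∨ (⌈r₁⌉ = ⌈r₂⌉ ∧ ⌊r₁⌋ = ⌊r₂⌋))) ∧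
  (∀ x y rx₁ ry₁ rx₂ ry₂, v₁ x = some rx₁ → v₁ y = some ry₁ →
      v₂ x = some rx₂ → v₂ y = some ry₂ → rx₁ ≤ (cmax : ℝ) → ry₁ ≤ (cmax : ℝ) →
      (fracDist x rx₁ ≤ fracDist y ry₁ ↔ fracDist x rx₂ ≤ fracDist y ry₂))

/-- The refined (Bouyer-style) region equivalence. -/
def RegEqD {α : Type} (cmax : ℕ) (v₁ v₂ : Val α) : Prop :=
  RegEq cmax v₁ v₂ ∧
  (∀ x y rx₁ ry₁ rx₂ ry₂, v₁ x = some rx₁ → v₁ y = some ry₁ →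
      v₂ x = some rx₂ → v₂ y = some ry₂ →
      ((cmax : ℝ) < rx₁ ∨ (cmax : ℝ) < ry₁) →
      ((2 * (cmax : ℝ) < |sval x rx₁ - sval y ry₁| ∧ 2 * (cmax : ℝ) < |sval x rx₂ - sval y ry₂|) ∨
       (⌊sval x rx₁ - sval y ry₁⌋ = ⌊sval x rx₂ - sval y ry₂⌋ ∧
        ⌈sval x rx₁ - sval y ry₁⌉ = ⌈sval x rx₂ - sval y ry₂⌉)))

/-- A region of an equivalence `E`: an equivalence class of nonnegative valuations. -/
def IsRegionOf {α : Type} (E : Val α → Val α → Prop) (r : Set (Val α)) : Prop :=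
  ∃ v, Nonneg v ∧ r = { v' | Nonneg v' ∧ E v v' }

def InitialRegion {α : Type} (r : Set (Val α)) : Prop := ∀ v ∈ r, InitialVal v
def FinalRegion {α : Type} (r : Set (Val α)) : Prop := ∀ v ∈ r, FinalVal v

/-- Acceptance in the universal region automaton `RA(∀,E,A)`. -/
inductive UAcc {α Q : Type} [DecidableEq α] (A : ECTA α Q) (E : Val α → Val α → Prop) :
    Q → Set (Val α) → List α → Prop where
  | nil : ∀ q r, q ∈ A.accept → IsRegionOf E r → FinalRegion r → UAcc A E q r []
  | cons : ∀ q r σ q' r' w, IsRegionOf E r → IsRegionOf E r' →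
      (∀ v ∈ r, ∃ t v', v' ∈ r' ∧ TStep A q v t σ q' v') →
      UAcc A E q' r' w → UAcc A E q r (σ :: w)

/-- Acceptance in the existential region automaton `RA(∃,E,A)`. -/
inductive EAcc {α Q : Type} [DecidableEq α] (A : ECTA α Q) (E : Val α → Val α → Prop) :
    Q → Set (Val α) → List α → Prop where
  | nil : ∀ q r, q ∈ A.accept → IsRegionOf E r → FinalRegion r → EAcc A E q r []
  | cons : ∀ q r σ q' r' w, IsRegionOf E r → IsRegionOf E r' →
      (∃ v ∈ r, ∃ t v', v' ∈ r' ∧ TStep A q v t σ q' v') →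
      EAcc A E q' r' w → EAcc A E q r (σ :: w)

/-- The language of the universal region automaton. -/
def ULang {α Q : Type} [DecidableEq α] (A : ECTA α Q) (E : Val α → Val α → Prop) :
    Set (List α) :=
  { w | ∃ r, IsRegionOf E r ∧ InitialRegion r ∧ UAcc A E A.init r w }

/-- The language of the existential region automaton. -/
def ELang {α Q : Type} [DecidableEq α] (A : ECTA α Q) (E : Val α → Val α → Prop) :
    Set (List α) :=
  { w | ∃ r, IsRegionOf E r ∧ InitialRegion r ∧ EAcc A E A.init r w }

/-- All constants in a constraint are at most `k`. -/
def Constr.BoundedBy {α : Type} (k : ℕ) : Constr α → Prop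
  | .tt => True
  | .lt _ c => c ≤ k
  | .gt _ c => c ≤ k
  | .eq _ c => c ≤ k
  | .not ψ => Constr.BoundedBy k ψ
  | .and ψ₁ ψ₂ => Constr.BoundedBy k ψ₁ ∧ Constr.BoundedBy k ψ₂

/-- `cmax` bounds all constants appearing in the guards of `A`. -/
def MaxConstLe {α Q : Type} (A : ECTA α Q) (k : ℕ) : Prop :=
  ∀ e ∈ A.edges, Constr.BoundedBy k e.2.2.1

/-- Finite strictly monotone partial maps on nonnegative reals extend. -/
theorem aux_interp (T : Finset (ℝ × ℝ)) (h0 : ((0 : ℝ), (0 : ℝ)) ∈ T)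
    (hlt : ∀ a ∈ T, ∀ b ∈ T, a.1 < b.1 → a.2 < b.2)
    (heq : ∀ a ∈ T, ∀ b ∈ T, a.1 = b.1 → a.2 = b.2) :
    ∃ h : ℝ → ℝ, (∀ z w, 0 ≤ z → z < w → h z < h w) ∧ ∀ a ∈ T, 0 ≤ a.1 → h a.1 = a.2 := by
  have hε : ∃ ε : ℝ, 0 < ε ∧ ∀ a ∈ T, ∀ b ∈ T, a.1 < b.1 → ε * (b.1 - a.1) < b.2 - a.2 := by
    have : ∀ᶠ ε : ℝ in nhdsWithin 0 (Set.Ioi 0), 0 < ε ∧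
        ∀ a ∈ T, ∀ b ∈ T, a.1 < b.1 → ε * (b.1 - a.1) < b.2 - a.2 := by
      refine Filter.Eventually.and self_mem_nhdsWithin ?_
      rw [Filter.eventually_all_finset]
      intro a ha
      rw [Filter.eventually_all_finset]
      intro b hb
      by_cases hab : a.1 < b.1
      · have h2 := hlt a ha b hb hab
        have hc : Filter.Tendsto (fun ε : ℝ => ε * (b.1 - a.1)) (nhdsWithin 0 (Set.Ioi 0))
            (nhds 0) := by
          have : Continuous (fun ε : ℝ => ε * (b.1 - a.1)) := by fun_prop
          have h3 := this.tendsto 0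
          simp only [zero_mul] at h3
          exact h3.mono_left nhdsWithin_le_nhds
        filter_upwards [hc.eventually_lt_const (sub_pos.2 h2)] with ε h _
        exact h
      · exact Filter.Eventually.of_forall (fun ε h => absurd h hab)
    exact this.exists
  obtain ⟨ε, hε0, hε⟩ := hε
  have hch : ∀ z : ℝ, ∃ a : ℝ × ℝ, 0 ≤ z → a ∈ T ∧ a.1 ≤ z ∧ ∀ b ∈ T, b.1 ≤ z → b.1 ≤ a.1 := by
    intro z
    by_cases hz : 0 ≤ z
    · obtain ⟨a, ha, hm⟩ := Finset.exists_max_image (T.filter (fun b => b.1 ≤ z)) Prod.fst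
        ⟨(0, 0), by simp [h0, hz]⟩
      simp only [Finset.mem_filter] at ha hm
      exact ⟨a, fun _ => ⟨ha.1, ha.2, fun b hb hbz => hm b ⟨hb, hbz⟩⟩⟩
    · exact ⟨(0, 0), fun h => absurd h hz⟩
  choose p hp using hch
  refine ⟨fun z => (p z).2 + ε * (z - (p z).1), ?_, ?_⟩
  · intro z w hz hzw
    obtain ⟨hz1, hz2, hz3⟩ := hp z hz
    obtain ⟨hw1, hw2, hw3⟩ := hp w (hz.trans hzw.le)
    have hle := hw3 _ hz1 (hz2.trans hzw.le)
    rcases hle.lt_or_eq with h | h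
    · have h1 := hε _ hz1 _ hw1 h
      have : ε * (z - (p z).1) < ε * (w - (p w).1) + ε * ((p w).1 - (p z).1) := by
        rw [← mul_add]; exact mul_lt_mul_of_pos_left (by linarith) hε0
      show (p z).2 + ε * (z - (p z).1) < (p w).2 + ε * (w - (p w).1)
      linarith
    · have h1 := heq _ hz1 _ hw1 h
      show (p z).2 + ε * (z - (p z).1) < (p w).2 + ε * (w - (p w).1)
      rw [h1, h]
      have := mul_lt_mul_of_pos_left (show z - (p w).1 < w - (p w).1 by linarith) hε0
      linarith
  · intro a ha ha0
    obtain ⟨h1, h2, h3⟩ := hp a.1 ha0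
    have h4 : (p a.1).1 = a.1 := le_antisymm h2 (h3 a ha le_rfl)
    show (p a.1).2 + ε * (a.1 - (p a.1).1) = a.2
    rw [heq _ h1 _ ha h4, h4]; ring

/-- Strictly increasing maps commuting with integer translations and fixing `0`. -/
structure GoodMap (f : ℝ → ℝ) : Prop where
  mono : StrictMono f
  shift : ∀ z, f (z + 1) = f z + 1
  zero : f 0 = 0

theorem GoodMap.add_int {f : ℝ → ℝ} (hf : GoodMap f) (z : ℝ) (n : ℤ) : f (z + n) = f z + n := by
  induction n using Int.induction_on with
  | zero => simp
  | succ i ih =>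
    push_cast at ih ⊢
    rw [← add_assoc, hf.shift, ih]; ring
  | pred i ih =>
    push_cast at ih ⊢
    have := hf.shift (z + (-(i : ℝ) - 1))
    rw [show z + (-(i : ℝ) - 1) + 1 = z + -(i : ℝ) by ring, ih] at this
    linarith

theorem GoodMap.int {f : ℝ → ℝ} (hf : GoodMap f) (n : ℤ) : f n = n := by
  have := hf.add_int 0 n
  simpa [hf.zero] using this

theorem GoodMap.floor {f : ℝ → ℝ} (hf : GoodMap f) (z : ℝ) : ⌊f z⌋ = ⌊z⌋ := by
  rw [Int.floor_eq_iff]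
  constructor
  · rw [← hf.int]; exact hf.mono.monotone (Int.floor_le z)
  · have := hf.mono (Int.lt_floor_add_one z)
    rwa [hf.shift, hf.int] at this

theorem GoodMap.ceil {f : ℝ → ℝ} (hf : GoodMap f) (z : ℝ) : ⌈f z⌉ = ⌈z⌉ := by
  rw [Int.ceil_eq_iff]
  constructor
  · have := hf.mono (show ((⌈z⌉ - 1 : ℤ) : ℝ) < z by push_cast; linarith [Int.ceil_lt_add_one z])
    rw [hf.int] at this; push_cast at this; exact this
  · rw [← hf.int ⌈z⌉]; exact hf.mono.monotone (Int.le_ceil z)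

theorem GoodMap.fract_le {f : ℝ → ℝ} (hf : GoodMap f) (a b : ℝ) :
    Int.fract (f a) ≤ Int.fract (f b) ↔ Int.fract a ≤ Int.fract b := by
  have h := hf.mono.le_iff_le (a := a + ((⌊b⌋ - ⌊a⌋ : ℤ) : ℝ)) (b := b)
  rw [hf.add_int] at h
  push_cast at h
  simp only [Int.fract, hf.floor]
  constructor
  · intro h1
    have := h.1 (by linarith)
    linarith
  · intro h1
    have := h.2 (by linarith)
    linarith

theorem GoodMap.translate {f : ℝ → ℝ} (hf : GoodMap f) (t : ℝ) :
    GoodMap (fun z => f (z + t) - f t) where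
  mono := fun a b h => by
    have := hf.mono (show a + t < b + t by linarith)
    show f (a + t) - f t < f (b + t) - f t
    linarith
  shift := fun z => by
    show f (z + 1 + t) - f t = f (z + t) - f t + 1
    rw [show z + 1 + t = z + t + 1 by ring, hf.shift]; ring
  zero := by simp

/-- Finite order-preserving data on fractional parts extends to a good map. -/
theorem exists_goodMap (T : Finset (ℝ × ℝ))
    (hfl : ∀ a ∈ T, ⌊a.1⌋ = ⌊a.2⌋) (hz : ∀ a ∈ T, Int.fract a.1 = 0 ↔ Int.fract a.2 = 0)
    (hfr : ∀ a ∈ T, ∀ b ∈ T, Int.fract a.1 ≤ Int.fract b.1 ↔ Int.fract a.2 ≤ Int.fract b.2) :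
    ∃ f, GoodMap f ∧ ∀ a ∈ T, f a.1 = a.2 := by
  classical
  set S : Finset (ℝ × ℝ) := insert (0, 0) (insert (1, 1)
    (T.image (fun a => (Int.fract a.1, Int.fract a.2)))) with hS
  have key : ∀ a ∈ S, ∀ b ∈ S, a.1 ≤ b.1 ↔ a.2 ≤ b.2 := by
    intro a ha b hb
    simp only [hS, Finset.mem_insert, Finset.mem_image] at ha hb
    rcases ha with rfl | rfl | ⟨a, ha, rfl⟩ <;> rcases hb with rfl | rfl | ⟨b, hb, rfl⟩
    · simp
    · simp
    · simp [Int.fract_nonneg]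
    · simp
    · simp
    · have h1 := Int.fract_lt_one b.1
      have h2 := Int.fract_lt_one b.2
      simp [not_le.2 h1, not_le.2 h2]
    · have h1 := Int.fract_nonneg a.1
      have h2 := Int.fract_nonneg a.2
      have := hz a ha
      simp only
      constructor
      · intro h; exact (this.1 (le_antisymm h h1)).le
      · intro h; exact (this.2 (le_antisymm h h2)).le
    · simp [(Int.fract_lt_one a.1).le, (Int.fract_lt_one a.2).le]
    · exact hfr a ha b hb
  obtain ⟨h, hmono, hval⟩ := aux_interp S (by simp [hS])
    (fun a ha b hb hab => by
      have := key b hb a ha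
      by_contra hc
      exact absurd (this.2 (not_lt.1 hc)) (not_le.2 hab))
    (fun a ha b hb hab => le_antisymm ((key a ha b hb).1 hab.le) ((key b hb a ha).1 hab.ge))
  have hh0 : h 0 = 0 := hval (0, 0) (by simp [hS]) le_rfl
  have hh1 : h 1 = 1 := hval (1, 1) (by simp [hS]) zero_le_one
  have hlt1 : ∀ z : ℝ, h (Int.fract z) < 1 := fun z => by
    rw [← hh1]; exact hmono _ _ (Int.fract_nonneg z) (Int.fract_lt_one z)
  have hge0 : ∀ z : ℝ, 0 ≤ h (Int.fract z) := fun z => by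
    rcases (Int.fract_nonneg z).lt_or_eq with hz | hz
    · have := hmono _ _ le_rfl hz
      rw [hh0] at this; exact this.le
    · rw [← hz, hh0]
  refine ⟨fun z => ⌊z⌋ + h (Int.fract z), ⟨?_, ?_, ?_⟩, ?_⟩
  · intro z w hzw
    show (⌊z⌋ : ℝ) + h (Int.fract z) < ⌊w⌋ + h (Int.fract w)
    rcases (Int.floor_mono hzw.le).lt_or_eq with hl | he
    · have : (⌊z⌋ : ℝ) + 1 ≤ ⌊w⌋ := by exact_mod_cast hl
      linarith [hlt1 z, hge0 w]
    · have : h (Int.fract z) < h (Int.fract w) := by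
        apply hmono _ _ (Int.fract_nonneg z)
        simp only [Int.fract, he]; linarith
      rw [he]; linarith
  · intro z
    simp only [Int.floor_add_one, Int.fract_add_one]
    push_cast; ring
  · simp [hh0]
  · intro a ha
    have h1 := hval (Int.fract a.1, Int.fract a.2)
      (by simp only [hS, Finset.mem_insert, Finset.mem_image]; exact Or.inr (Or.inr ⟨a, ha, rfl⟩))
      (Int.fract_nonneg _)
    simp only at h1
    show (⌊a.1⌋ : ℝ) + h (Int.fract a.1) = a.2
    rw [h1, hfl a ha]; exact Int.floor_add_fract a.2

/-- Event time relative to now. -/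
def ev {α : Type} : Clock α → ℝ → ℝ
  | .hist _, r => -r
  | .proph _, r => r

theorem fracDist_eq {α : Type} (x : Clock α) (r : ℝ) : fracDist x r = Int.fract (ev x r) := by
  cases x with
  | hist a => simp [fracDist, ev, Int.fract, Int.floor_neg]; ring
  | proph a => rfl

theorem floor_ceil_ev {α : Type} (x : Clock α) (r s : ℝ) :
    (⌈r⌉ = ⌈s⌉ ∧ ⌊r⌋ = ⌊s⌋) ↔ (⌈ev x r⌉ = ⌈ev x s⌉ ∧ ⌊ev x r⌋ = ⌊ev x s⌋) := by
  cases x with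
  | hist a => simp [ev, Int.floor_neg, Int.ceil_neg, and_comm]
  | proph a => simp [ev]

theorem ev_inj {α : Type} (x : Clock α) {r s : ℝ} (h : ev x r = ev x s) : r = s := by
  cases x <;> simpa [ev] using h

theorem le_nat_of_ceil {r s : ℝ} {c : ℕ} (h : ⌈r⌉ = ⌈s⌉) : r ≤ c ↔ s ≤ c := by
  have h1 := Int.ceil_le (a := r) (z := (c : ℤ))
  have h2 := Int.ceil_le (a := s) (z := (c : ℤ))
  rw [h] at h1
  push_cast at h1 h2
  exact h1.symm.trans h2

/-- `u` is the image of `v` under `f`, up to clocks above `cmax`. -/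
def ImgRel {α : Type} (cmax : ℕ) (f : ℝ → ℝ) (u v : Val α) : Prop :=
  ∀ x, (v x = none ∧ u x = none) ∨ ∃ rv ru, v x = some rv ∧ u x = some ru ∧
    (((cmax : ℝ) < rv ∧ (cmax : ℝ) < ru) ∨ ev x ru = f (ev x rv))

theorem RegEq.refl {α : Type} (cmax : ℕ) (v : Val α) : RegEq cmax v v := by
  refine ⟨fun _ => Iff.rfl, ?_, ?_⟩
  · intro x r₁ r₂ h1 h2
    have : r₁ = r₂ := by rw [h1] at h2; exact Option.some.inj h2
    subst this; right; exact ⟨rfl, rfl⟩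
  · intro x y a b c d h1 h2 h3 h4 _ _
    rw [h1] at h3; rw [h2] at h4
    rw [Option.some.inj h3, Option.some.inj h4]

theorem RegEq.small {α : Type} {cmax : ℕ} {v₁ v₂ : Val α} (h : RegEq cmax v₁ v₂) {x r₁ r₂}
    (h1 : v₁ x = some r₁) (h2 : v₂ x = some r₂) : r₁ ≤ cmax ↔ r₂ ≤ cmax := by
  rcases h.2.1 x r₁ r₂ h1 h2 with ⟨ha, hb⟩ | ⟨ha, _⟩
  · exact ⟨fun h => absurd h (not_le.2 ha), fun h => absurd h (not_le.2 hb)⟩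
  · exact le_nat_of_ceil ha

theorem RegEq.symm {α : Type} {cmax : ℕ} {v₁ v₂ : Val α} (h : RegEq cmax v₁ v₂) :
    RegEq cmax v₂ v₁ := by
  refine ⟨fun x => (h.1 x).symm, ?_, ?_⟩
  · intro x r₁ r₂ h1 h2
    rcases h.2.1 x r₂ r₁ h2 h1 with ⟨ha, hb⟩ | ⟨ha, hb⟩
    · exact Or.inl ⟨hb, ha⟩
    · exact Or.inr ⟨ha.symm, hb.symm⟩
  · intro x y a b c d h1 h2 h3 h4 ha hb
    exact (h.2.2 x y c d a b h3 h4 h1 h2 ((h.small h3 h1).2 ha) ((h.small h4 h2).2 hb)).symm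

theorem RegEq.get {α : Type} {cmax : ℕ} {v₁ v₂ : Val α} (h : RegEq cmax v₁ v₂) {x r}
    (h1 : v₁ x = some r) : ∃ s, v₂ x = some s := by
  rw [← Option.ne_none_iff_exists']
  intro hn
  rw [← h.1 x, h1] at hn
  cases hn

theorem RegEq.trans {α : Type} {cmax : ℕ} {v₁ v₂ v₃ : Val α} (h : RegEq cmax v₁ v₂)
    (h' : RegEq cmax v₂ v₃) : RegEq cmax v₁ v₃ := by
  refine ⟨fun x => (h.1 x).trans (h'.1 x), ?_, ?_⟩
  · intro x r₁ r₃ h1 h3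
    obtain ⟨r₂, h2⟩ := h.get h1
    have hs := h.small h1 h2
    have hs' := h'.small h2 h3
    rcases h.2.1 x _ _ h1 h2 with ⟨ha, hb⟩ | ⟨ha, hb⟩
    · left; refine ⟨ha, ?_⟩
      by_contra hc
      exact absurd (hs'.2 (not_lt.1 hc)) (not_le.2 hb)
    · rcases h'.2.1 x _ _ h2 h3 with ⟨hc, hd⟩ | ⟨hc, hd⟩
      · left; refine ⟨?_, hd⟩
        by_contra he
        exact absurd (hs.1 (not_lt.1 he)) (not_le.2 hc)
      · right; exact ⟨ha.trans hc, hb.trans hd⟩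
  · intro x y a b c d h1 h2 h3 h4 ha hb
    obtain ⟨e, he⟩ := h.get h1
    obtain ⟨g, hg⟩ := h.get h2
    exact (h.2.2 x y a b e g h1 h2 he hg ha hb).trans
      (h'.2.2 x y e g c d he hg h3 h4 ((h.small h1 he).1 ha) ((h.small h2 hg).1 hb))

theorem ImgRel.regEq {α : Type} {cmax : ℕ} {f : ℝ → ℝ} (hf : GoodMap f) {u v : Val α}
    (h : ImgRel cmax f u v) : RegEq cmax v u := by
  have h2 : ∀ x r₁ r₂, v x = some r₁ → u x = some r₂ →
      (((cmax : ℝ) < r₁ ∧ (cmax : ℝ) < r₂) ∨ ev x r₂ = f (ev x r₁)) := by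
    intro x r₁ r₂ h1 h2
    rcases h x with ⟨hn, _⟩ | ⟨rv, ru, hv, hu, hh⟩
    · rw [hn] at h1; cases h1
    · rw [hv] at h1; rw [hu] at h2; cases h1; cases h2; exact hh
  refine ⟨?_, ?_, ?_⟩
  · intro x
    rcases h x with ⟨h1, h2⟩ | ⟨rv, ru, h1, h2, _⟩ <;> simp [h1, h2]
  · intro x r₁ r₂ h1 h3
    rcases h2 x r₁ r₂ h1 h3 with h | h
    · exact Or.inl h
    · right
      rw [floor_ceil_ev x, h, hf.floor, hf.ceil]; exact ⟨rfl, rfl⟩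
  · intro x y a b c d h1 h3 h4 h5 ha hb
    rcases h2 x _ _ h1 h4 with h | h
    · exact absurd ha (not_le.2 h.1)
    rcases h2 y _ _ h3 h5 with h' | h'
    · exact absurd hb (not_le.2 h'.1)
    rw [fracDist_eq, fracDist_eq, fracDist_eq, fracDist_eq, h, h', hf.fract_le]

theorem RegEq.exists_rel {α : Type} {cmax : ℕ} {u v : Val α} (h : RegEq cmax v u)
    (hfin : {x | v x ≠ none}.Finite) : ∃ f, GoodMap f ∧ ImgRel cmax f u v := by
  classical
  set D := hfin.toFinset.filter (fun x => (v x).getD 0 ≤ cmax) with hD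
  set T : Finset (ℝ × ℝ) := D.image (fun x => (ev x ((v x).getD 0), ev x ((u x).getD 0))) with hT
  have hTm : ∀ a ∈ T, ∃ x rv ru, v x = some rv ∧ u x = some ru ∧ rv ≤ cmax ∧
      a = (ev x rv, ev x ru) := by
    intro a ha
    simp only [hT, hD, Finset.mem_image, Finset.mem_filter, Set.Finite.mem_toFinset,
      Set.mem_ofPred_eq] at ha
    obtain ⟨x, ⟨hx, hc⟩, rfl⟩ := ha
    obtain ⟨rv, hrv⟩ := Option.ne_none_iff_exists'.1 hx
    obtain ⟨ru, hru⟩ := h.get hrv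
    refine ⟨x, rv, ru, hrv, hru, ?_, ?_⟩
    · simpa [hrv] using hc
    · simp [hrv, hru]
  have hfc : ∀ x rv ru, v x = some rv → u x = some ru → rv ≤ cmax →
      (⌈ev x rv⌉ = ⌈ev x ru⌉ ∧ ⌊ev x rv⌋ = ⌊ev x ru⌋) := by
    intro x rv ru h1 h2 h3
    rcases h.2.1 x rv ru h1 h2 with h4 | h4
    · exact absurd h3 (not_le.2 h4.1)
    · exact (floor_ceil_ev x _ _).1 h4
  have hfz : ∀ z : ℝ, Int.fract z = 0 ↔ ⌈z⌉ = ⌊z⌋ := by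
    intro z
    constructor
    · intro hz
      have : z = ⌊z⌋ := by have := Int.floor_add_fract z; rw [hz] at this; linarith
      rw [this]; simp
    · intro hz
      have h1 := Int.le_ceil z
      have h2 := Int.floor_le z
      rw [hz] at h1
      simp only [Int.fract]; linarith
  obtain ⟨f, hf, hv⟩ := exists_goodMap T
    (by
      intro a ha
      obtain ⟨x, rv, ru, h1, h2, h3, rfl⟩ := hTm a ha
      exact (hfc x rv ru h1 h2 h3).2)
    (by
      intro a ha
      obtain ⟨x, rv, ru, h1, h2, h3, rfl⟩ := hTm a ha
      obtain ⟨h4, h5⟩ := hfc x rv ru h1 h2 h3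
      simp only [hfz, h4, h5])
    (by
      intro a ha b hb
      obtain ⟨x, rv, ru, h1, h2, h3, rfl⟩ := hTm a ha
      obtain ⟨y, sv, su, k1, k2, k3, rfl⟩ := hTm b hb
      have := h.2.2 x y rv sv ru su h1 k1 h2 k2 h3 k3
      simpa only [fracDist_eq] using this)
  refine ⟨f, hf, ?_⟩
  intro x
  rcases hvx : v x with _ | rv
  · left; exact ⟨rfl, (h.1 x).1 hvx⟩
  · right
    obtain ⟨ru, hru⟩ := h.get hvx
    refine ⟨rv, ru, rfl, hru, ?_⟩
    rcases h.2.1 x rv ru hvx hru with h1 | h1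
    · exact Or.inl h1
    · by_cases hc : rv ≤ cmax
      · right
        have : (ev x rv, ev x ru) ∈ T := by
          simp only [hT, hD, Finset.mem_image, Finset.mem_filter, Set.Finite.mem_toFinset,
            Set.mem_ofPred_eq]
          exact ⟨x, ⟨by simp [hvx], by simpa [hvx] using hc⟩, by simp [hvx, hru]⟩
        exact (hv _ this).symm
      · left
        exact ⟨not_le.1 hc, not_le.1 (fun h2 => hc ((h.small hvx hru).2 h2))⟩

/-- Guards cannot distinguish region-equivalent values. -/
theorem sat_congr {α : Type} {cmax : ℕ} {v₁ v₂ : Val α}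
    (h : ∀ x, (v₁ x = none ∧ v₂ x = none) ∨ ∃ r s, v₁ x = some r ∧ v₂ x = some s ∧
      (((cmax : ℝ) < r ∧ (cmax : ℝ) < s) ∨ (⌈r⌉ = ⌈s⌉ ∧ ⌊r⌋ = ⌊s⌋)))
    (ψ : Constr α) (hb : ψ.BoundedBy cmax) : Constr.sat v₁ ψ ↔ Constr.sat v₂ ψ := by
  have key : ∀ (r s : ℝ) (c : ℕ), c ≤ cmax →
      (((cmax : ℝ) < r ∧ (cmax : ℝ) < s) ∨ (⌈r⌉ = ⌈s⌉ ∧ ⌊r⌋ = ⌊s⌋)) →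
      ((r ≤ c ↔ s ≤ c) ∧ (r < c ↔ s < c)) := by
    intro r s c hc hrs
    have hc' : (c : ℝ) ≤ cmax := by exact_mod_cast hc
    rcases hrs with ⟨h1, h2⟩ | ⟨h1, h2⟩
    · constructor <;> constructor <;> intro <;> linarith
    · refine ⟨le_nat_of_ceil h1, ?_⟩
      have h3 := Int.floor_lt (a := r) (z := (c : ℤ))
      have h4 := Int.floor_lt (a := s) (z := (c : ℤ))
      rw [h2] at h3
      push_cast at h3 h4
      exact h3.symm.trans h4
  induction ψ with
  | tt => exact Iff.rfl
  | lt x c =>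
    rcases h x with ⟨h1, h2⟩ | ⟨r, s, h1, h2, h3⟩
    · simp [Constr.sat, h1, h2]
    · simp [Constr.sat, h1, h2, (key r s c hb h3).2]
  | gt x c =>
    rcases h x with ⟨h1, h2⟩ | ⟨r, s, h1, h2, h3⟩
    · simp [Constr.sat, h1, h2]
    · have := (key r s c hb h3).1
      simp only [Constr.sat, h1, h2, Option.some.injEq, exists_eq_left', ← not_le, this]
  | eq x c =>
    rcases h x with ⟨h1, h2⟩ | ⟨r, s, h1, h2, h3⟩
    · simp [Constr.sat, h1, h2]
    · obtain ⟨k1, k2⟩ := key r s c hb h3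
      simp only [Constr.sat, h1, h2, Option.some.injEq]
      have e : ∀ z : ℝ, z = c ↔ (z ≤ c ∧ ¬ z < c) := fun z =>
        ⟨fun h => ⟨h.le, not_lt.2 h.ge⟩, fun h => le_antisymm h.1 (not_lt.1 h.2)⟩
      rw [e, e, k1, k2]
  | not ψ ih => exact not_congr (ih hb)
  | and ψ₁ ψ₂ ih₁ ih₂ => exact and_congr (ih₁ hb.1) (ih₂ hb.2)

/-- Equality up to prophecy clocks above `cmax`. -/
def Wk {α : Type} (cmax : ℕ) (u' u : Val α) : Prop :=
  (∀ a, u' (.hist a) = u (.hist a)) ∧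
  ∀ a, u' (.proph a) = u (.proph a) ∨ ∃ r s, u' (.proph a) = some r ∧ u (.proph a) = some s ∧
    (cmax : ℝ) < r ∧ (cmax : ℝ) < s

theorem mem_dom_iff {α : Type} {cmax : ℕ} {r : Set (Val α)} (hr : IsRegionOf (RegEq cmax) r)
    {u v : Val α} (hu : u ∈ r) (hv : v ∈ r) : RegEq cmax u v := by
  obtain ⟨v0, _, rfl⟩ := hr
  exact hu.2.symm.trans hv.2

theorem EAcc.finite_proph {α Q : Type} [DecidableEq α] {A : ECTA α Q} {cmax : ℕ} {q r w}
    (h : EAcc A (RegEq cmax) q r w) : ∀ v ∈ r, {a | v (.proph a) ≠ none}.Finite := by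
  induction h with
  | nil q r hq hr hf =>
    intro v hv
    have : {a | v (.proph a) ≠ none} = ∅ := by
      ext a; simp [hf v hv a]
    rw [this]; exact Set.finite_empty
  | cons q r σ q' r' w hr hr' hs _ ih =>
    intro v hv
    obtain ⟨v0, hv0, t, v', hv', hce, ψ, _, vb, _, hb1, hb2, _⟩ := hs
    refine ((ih v' hv').insert σ).subset ?_
    intro a ha
    have hreg := mem_dom_iff hr hv hv0
    rw [Set.mem_insert_iff]
    by_cases hσ : a = σ
    · exact Or.inl hσ
    right
    intro hn
    apply ha
    rw [hreg.1]
    have h1 := congrFun hb1 (.proph a)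
    have h2 := congrFun hb2 (.proph a)
    rw [hn] at h2
    simp [Val.set] at h2
    simp [Val.set, hσ, elapse, h2] at h1
    rcases h3 : v0 (.proph a) with _ | z
    · rfl
    · rw [h3] at h1; simp at h1

theorem finite_dom {α : Type} {v : Val α} (h1 : {a | v (.hist a) ≠ none}.Finite)
    (h2 : {a | v (.proph a) ≠ none}.Finite) : {x | v x ≠ none}.Finite := by
  refine ((h1.image Clock.hist).union (h2.image Clock.proph)).subset ?_
  intro x hx
  cases x with
  | hist a => exact Or.inl ⟨a, hx, rfl⟩
  | proph a => exact Or.inr ⟨a, hx, rfl⟩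

theorem GoodMap.gt_nat {f : ℝ → ℝ} (hf : GoodMap f) (c : ℕ) (z : ℝ) : (c : ℝ) < f z ↔ (c : ℝ) < z := by
  have := hf.mono.lt_iff_lt (a := (c : ℝ)) (b := z)
  have h2 := hf.int c
  push_cast at h2
  rwa [h2] at this

theorem main_lift {α Q : Type} [DecidableEq α] {A : ECTA α Q} {cmax : ℕ}
    (hmax : MaxConstLe A cmax) {q r w}
    (h : EAcc A (RegEq cmax) q r w) : ∀ u ∈ r, {a | u (.hist a) ≠ none}.Finite →
      ∃ u', Wk cmax u' u ∧ w ∈ UntimedLangFrom A q u' := by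
  induction h with
  | nil q r hq hr hf =>
    intro u hu _
    exact ⟨u, ⟨fun _ => rfl, fun _ => Or.inl rfl⟩, [], ECAcc.nil q u hq (hf u hu), rfl⟩
  | cons q r σ q' r' w hr hr' hs hacc ih =>
    intro u hu hufin
    have hpfin := (EAcc.cons q r σ q' r' w hr hr' hs hacc).finite_proph u hu
    obtain ⟨v, hv, t, v', hv', ⟨ht0, hce⟩, ψ, hedge, vb, hvbn, hb1, hb2, hsat⟩ := hs
    have hvu := mem_dom_iff hr hv hu
    have hvfin : {x | v x ≠ none}.Finite := by
      refine (finite_dom hufin hpfin).subset ?_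
      intro x hx hn
      exact hx ((hvu.1 x).2 hn)
    obtain ⟨f, hf, hrel⟩ := hvu.exists_rel hvfin
    have hg := hf.translate t
    set g : ℝ → ℝ := fun z => f (z + t) - f t with hgdef
    have hft : 0 ≤ f t := by rw [← hf.zero]; exact hf.mono.monotone ht0
    have hun : Nonneg u := by obtain ⟨v0, _, rfl⟩ := hr; exact hu.1
    -- components of vb
    have hvh : ∀ a, vb (.hist a) = (v (.hist a)).map (· + t) := by
      intro a
      have := congrFun hb1 (.hist a)
      simpa [Val.set, elapse] using this
    have hvp : ∀ a, a ≠ σ → vb (.proph a) = (v (.proph a)).map (· - t) := by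
      intro a ha
      have := congrFun hb1 (.proph a)
      simpa [Val.set, elapse, ha] using this
    have hvσ : v (.proph σ) = some t := by
      have := congrFun hb1 (.proph σ)
      simp only [Val.set, elapse, if_true] at this
      rcases h3 : v (.proph σ) with _ | z
      · rw [h3] at this; simp at this
      · rw [h3] at this
        simp only [Option.map_some, Option.some.injEq] at this
        rw [show z = t by linarith]
    -- the lifted middle valuation
    let ub : Val α := fun x => match x with
      | .hist a => (u (.hist a)).map (· + f t)
      | .proph a => (vb (.proph a)).map g
    have hubrel : ImgRel cmax g ub vb := by
      intro x
      cases x with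
      | hist a =>
        rcases hrel (.hist a) with ⟨h1, h2⟩ | ⟨rv, ru, h1, h2, h3⟩
        · left; exact ⟨by simp [hvh, h1], by simp [ub, h2]⟩
        · right
          refine ⟨rv + t, ru + f t, by simp [hvh, h1], by simp [ub, h2], ?_⟩
          rcases h3 with ⟨h3, h4⟩ | h3
          · left; constructor <;> linarith
          · right
            simp only [ev] at h3 ⊢
            simp only [hgdef]
            rw [show -(rv + t) + t = -rv by ring, ← h3]; ring
      | proph a =>
        rcases h1 : vb (.proph a) with _ | z
        · left; exact ⟨rfl, by simp [ub, h1]⟩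
        · right; exact ⟨z, g z, rfl, by simp [ub, h1], Or.inr rfl⟩
    have hubn : Nonneg ub := by
      intro x z hz
      cases x with
      | hist a =>
        simp only [ub, Option.map_eq_some_iff] at hz
        obtain ⟨y, hy, rfl⟩ := hz
        have := hun _ _ hy
        linarith
      | proph a =>
        simp only [ub, Option.map_eq_some_iff] at hz
        obtain ⟨y, hy, rfl⟩ := hz
        rw [← hg.zero]
        exact hg.mono.monotone (hvbn _ _ hy)
    have hrel' : ImgRel cmax g (ub.set (.hist σ) (some 0)) v' := by
      rw [← hb2]
      intro x
      by_cases hx : x = .hist σ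
      · right
        subst hx
        refine ⟨0, 0, by simp [Val.set], by simp [Val.set], Or.inr ?_⟩
        simp [ev, hg.zero]
      · have := hubrel x
        simpa [Val.set, hx] using this
    have hmem : ub.set (.hist σ) (some 0) ∈ r' := by
      have hreg := hrel'.regEq hg
      obtain ⟨v0, _, rfl⟩ := hr'
      refine ⟨?_, hv'.2.trans hreg⟩
      intro x z hz
      by_cases hx : x = .hist σ
      · simp [Val.set, hx] at hz
        exact hz.le
      · simp [Val.set, hx] at hz
        exact hubn x _ hz
    obtain ⟨us, ⟨hus1, hus2⟩, θ, hθ, hθw⟩ := ih _ hmem (by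
      refine (hufin.insert σ).subset ?_
      intro a ha
      rw [Set.mem_insert_iff]
      by_cases hσ : a = σ
      · exact Or.inl hσ
      right
      intro hn
      apply ha
      simp [Val.set, hσ, ub, hn])
    have hus2' : ∀ a, us (.proph a) = ub (.proph a) ∨ ∃ r s, us (.proph a) = some r ∧
        ub (.proph a) = some s ∧ (cmax : ℝ) < r ∧ (cmax : ℝ) < s := by
      intro a
      have := hus2 a
      simpa [Val.set] using this
    let ubs : Val α := fun x => match x with
      | .hist a => ub (.hist a)
      | .proph a => us (.proph a)
    have hcm : (0 : ℝ) ≤ cmax := Nat.cast_nonneg _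
    have hubsn : Nonneg ubs := by
      intro x z hz
      cases x with
      | hist a => exact hubn (.hist a) _ hz
      | proph a =>
        change us (.proph a) = some z at hz
        rcases hus2' a with h1 | ⟨r, s, h1, _, h3, _⟩
        · rw [h1] at hz; exact hubn (.proph a) _ hz
        · rw [h1] at hz; cases hz; linarith
    let un : Val α := fun x => match x with
      | .hist a => u (.hist a)
      | .proph a => ((ubs.set (.proph σ) (some 0)) (.proph a)).map (· + f t)
    refine ⟨un, ⟨fun _ => rfl, ?_⟩, (f t, σ) :: θ, ?_, by simp [hθw]⟩
    · intro a
      by_cases hσ : a = σ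
      · subst hσ
        have h1 : un (.proph a) = some (f t) := by simp [un, Val.set]
        rw [h1]
        rcases hrel (.proph a) with ⟨h2, _⟩ | ⟨rv, ru, h2, h3, h4⟩
        · rw [hvσ] at h2; cases h2
        · rw [hvσ] at h2; cases h2
          rw [h3]
          rcases h4 with ⟨h4, h5⟩ | h4
          · right; exact ⟨_, _, rfl, rfl, (hf.gt_nat _ _).2 h4, h5⟩
          · left; simp only [ev] at h4; rw [h4]
      · have h1 : un (.proph a) = (us (.proph a)).map (· + f t) := by
          simp [un, Val.set, hσ, ubs]
        rw [h1]
        rcases hrel (.proph a) with ⟨h2, h3⟩ | ⟨rv, ru, h2, h3, h4⟩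
        · have h5 : ub (.proph a) = none := by simp [ub, hvp a hσ, h2]
          left
          rcases hus2' a with h6 | ⟨_, s, _, h6, _⟩
          · rw [h6, h5, h3]; rfl
          · rw [h5] at h6; cases h6
        · have h5 : ub (.proph a) = some (f rv - f t) := by
            simp [ub, hvp a hσ, h2, hgdef]
          rcases hus2' a with h6 | ⟨y, s, h6, h7, h8, h9⟩
          · rw [h6, h5, h3]
            rcases h4 with ⟨h4, h7⟩ | h4
            · right
              refine ⟨_, _, rfl, rfl, ?_, h7⟩
              show (cmax : ℝ) < f rv - f t + f t
              have := (hf.gt_nat cmax rv).2 h4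
              linarith
            · left
              simp only [ev] at h4
              rw [h4]; simp
          · right
            rw [h5] at h7; cases h7
            rw [h6]
            refine ⟨_, _, rfl, h3, ?_, ?_⟩
            · show (cmax : ℝ) < y + f t
              linarith
            · rcases h4 with ⟨_, h4⟩ | h4
              · exact h4
              · simp only [ev] at h4
                rw [h4]; linarith
    · refine ECAcc.cons _ _ _ _ q' us _ ⟨⟨hft, ?_⟩, ψ, hedge, ubs, hubsn, ?_, ?_, ?_⟩ hθ
      · intro a z hz
        simp only [un, Option.map_eq_some_iff] at hz
        obtain ⟨y, hy, rfl⟩ := hz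
        have : 0 ≤ y := by
          by_cases hσ : a = σ
          · simp [Val.set, hσ] at hy; exact hy.le
          · simp [Val.set, hσ] at hy; exact hubsn (.proph a) _ hy
        linarith
      · funext x
        cases x with
        | hist a => simp [Val.set, elapse, un, ubs, ub]
        | proph a =>
          simp only [elapse, un, Option.map_map]
          rcases (ubs.set (.proph σ) (some 0)) (.proph a) with _ | y <;> simp
      · funext x
        cases x with
        | hist a => rw [hus1 a]; simp [Val.set, ubs]
        | proph a => simp [Val.set, ubs]
      · have hbd : ψ.BoundedBy cmax := hmax _ hedge
        refine (sat_congr ?_ ψ hbd).1 hsat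
        intro x
        have hR := hubrel.regEq hg
        rcases h1 : vb x with _ | z
        · left
          have h2 := (hR.1 x).1 h1
          refine ⟨rfl, ?_⟩
          cases x with
          | hist a => exact h2
          | proph a =>
            rcases hus2' a with h6 | ⟨_, s, _, h6, _⟩
            · show us _ = none
              rw [h6, h2]
            · rw [h2] at h6; cases h6
        · right
          obtain ⟨y, hy⟩ := hR.get h1
          have h3 := hR.2.1 x z y h1 hy
          cases x with
          | hist a => exact ⟨z, y, rfl, hy, h3⟩
          | proph a =>
            rcases hus2' a with h6 | ⟨p, s, h5, h6, h7, h8⟩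
            · refine ⟨z, y, rfl, ?_, h3⟩
              show us _ = _
              rw [h6, hy]
            · rw [hy] at h6; cases h6
              refine ⟨z, p, rfl, h5, Or.inl ⟨?_, h7⟩⟩
              exact not_le.1 (fun h => absurd ((hR.small h1 hy).1 h) (not_le.2 h8))

theorem acc_region {α Q : Type} [DecidableEq α] {A : ECTA α Q} {cmax : ℕ} {q v θ}
    (h : ECAcc A q v θ) : Nonneg v →
      EAcc A (RegEq cmax) q {v' | Nonneg v' ∧ RegEq cmax v v'} (θ.map Prod.snd) := by
  induction h with
  | nil q v hq hf =>
    intro hv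
    refine EAcc.nil _ _ hq ⟨v, hv, rfl⟩ ?_
    intro v' hv' a
    exact (hv'.2.1 _).1 (hf a)
  | cons q v t σ q' v' w hs _ ih =>
    intro hv
    have hv' : Nonneg v' := by
      obtain ⟨_, ψ, _, vb, hn, _, hb2, _⟩ := hs
      rw [← hb2]
      intro x z hz
      by_cases hx : x = .hist σ
      · simp [Val.set, hx] at hz
        exact hz.le
      · simp [Val.set, hx] at hz
        exact hn _ _ hz
    exact EAcc.cons _ _ _ _ _ _ ⟨v, hv, rfl⟩ ⟨v', hv', rfl⟩
      ⟨v, ⟨hv, RegEq.refl _ _⟩, t, v', ⟨hv', RegEq.refl _ _⟩, hs⟩ (ih hv')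

/-- The existential Alur–Dill region automaton recognizes exactly the untimed
language: `L(RA(∃,Reg,A)) ⊆ Untime(L(A))` and in fact equality holds. -/
theorem existential_region_automaton_correct
    {α Q : Type} [DecidableEq α] (A : ECTA α Q) (cmax : ℕ)
    (hmax : MaxConstLe A cmax) :
    ELang A (RegEq cmax) ⊆ UntimedLang A ∧ ELang A (RegEq cmax) = UntimedLang A := by
  have h1 : ELang A (RegEq cmax) ⊆ UntimedLang A := by
    rintro w ⟨r, hr, hi, hacc⟩
    obtain ⟨v, hv, hrv⟩ := id hr
    have hvr : v ∈ r := by rw [hrv]; exact ⟨hv, RegEq.refl _ _⟩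
    obtain ⟨u, ⟨hu1, hu2⟩, hw⟩ := main_lift hmax hacc v hvr (by
      have : {a | v (.hist a) ≠ none} = ∅ := by
        ext a; simp [hi v hvr a]
      rw [this]; exact Set.finite_empty)
    refine ⟨u, ?_, fun a => by rw [hu1, hi v hvr a], hw⟩
    intro x z hz
    cases x with
    | hist a => rw [hu1] at hz; exact hv _ _ hz
    | proph a =>
      rcases hu2 a with h | ⟨p, s, h, _, hp, _⟩
      · rw [h] at hz; exact hv _ _ hz
      · rw [h] at hz; cases hz
        exact (Nat.cast_nonneg cmax).trans hp.le
  refine ⟨h1, Set.Subset.antisymm h1 ?_⟩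
  rintro w ⟨v, hv, hi, θ, hθ, rfl⟩
  refine ⟨_, ⟨v, hv, rfl⟩, ?_, acc_region hθ hv⟩
  intro v' hv' a
  exact (hv'.2.1 _).1 (hi a)
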